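/- For α ≤ 0, the q-Abel polynomials (A_0^{(q,α)}, …, A_n^{(q,α)}) form a strictly totally positive basis of the space of polynomials of degree ≤ n on (0, ∞); i.e., every collocation matrix (A_{j-1}^{(q,α)}(t_i))_{1 ≤ i,j ≤ n+1} at increasing positive nodes 0 < t_1 < ⋯ < t_{n+1} is strictly totally positive. -/

import Mathlib

open Finset Matrix

noncomputable def qInt (q : ℝ) (m : ℕ) : ℝ := ∑ i ∈ Finset.range m, q ^ i

noncomputable def qFact (q : ℝ) (m : ℕ) : ℝ := ∏ i ∈ Finset.range m, qInt q (i + 1)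

noncomputable def qBinom (q : ℝ) (m k : ℕ) : ℝ :=
  if k ≤ m then qFact q m / (qFact q k * qFact q (m - k)) else 0

noncomputable def qAbel (q α : ℝ) (m : ℕ) (x : ℝ) : ℝ :=
  if m = 0 then 1 else x * ∏ j ∈ Finset.Icc 1 (m - 1), (x * q ^ j - α * qInt q m)

def IsTotallyPos {n : ℕ} (A : Matrix (Fin n) (Fin n) ℝ) : Prop :=
  ∀ (k : ℕ) (f g : Fin k → Fin n), StrictMono f → StrictMono g →
    0 ≤ (A.submatrix f g).det

def IsStrictTotallyPos {n : ℕ} (A : Matrix (Fin n) (Fin n) ℝ) : Prop :=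
  ∀ (k : ℕ) (f g : Fin k → Fin n), StrictMono f → StrictMono g →
    0 < (A.submatrix f g).det

/-- Strict total positivity on `(0, ∞)` of a sequence of functions. -/
def STPFam (φ : ℕ → ℝ → ℝ) : Prop :=
  ∀ (k : ℕ) (t : Fin k → ℝ) (g : Fin k → ℕ), (∀ i, 0 < t i) → StrictMono t → StrictMono g →
    0 < (Matrix.of fun i j : Fin k => φ (g j) (t i)).det

theorem STPFam.bidiag {φ : ℕ → ℝ → ℝ} (h : STPFam φ) (a b : ℕ → ℝ)
    (ha : ∀ s, 0 < a s) (hb : ∀ s, 0 ≤ b s) :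
    STPFam (fun s x => a s * φ s x + b s * φ (s - 1) x) := by
  intro k t g ht htm hg
  have hterm : ∀ S : Finset (Fin k),
      (Matrix.detRowAlternating (R := ℝ)).toMultilinearMap
        (S.piecewise (fun j i => a (g j) * φ (g j) (t i))
          (fun j i => b (g j) * φ (g j - 1) (t i)))
      = (∏ j, (if j ∈ S then a (g j) else b (g j))) *
        (Matrix.of fun i j : Fin k => φ (if j ∈ S then g j else g j - 1) (t i)).det := by
    intro S
    rw [← Matrix.det_transpose (Matrix.of fun i j : Fin k => φ (if j ∈ S then g j else g j - 1) (t i)),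
      ← Matrix.det_mul_column]
    change Matrix.det _ = _
    congr 1
    ext j i
    by_cases hj : j ∈ S <;> simp [Finset.piecewise, hj]
  have hexp : (Matrix.of fun i j : Fin k =>
        (fun s x => a s * φ s x + b s * φ (s - 1) x) (g j) (t i)).det
      = ∑ S : Finset (Fin k), (∏ j, (if j ∈ S then a (g j) else b (g j))) *
        (Matrix.of fun i j : Fin k => φ (if j ∈ S then g j else g j - 1) (t i)).det := by
    rw [← Finset.sum_congr rfl (fun S _ => hterm S), ← MultilinearMap.map_add_univ,
      ← Matrix.det_transpose]
    rfl
  rw [hexp]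
  apply Finset.sum_pos'
  · intro S _
    apply mul_nonneg
    · apply Finset.prod_nonneg
      intro j _
      split_ifs
      · exact (ha _).le
      · exact hb _
    · by_cases hinj : Function.Injective (fun j => if j ∈ S then g j else g j - 1)
      · have hmono : Monotone (fun j => if j ∈ S then g j else g j - 1) := by
          intro j j' hjj
          rcases hjj.eq_or_lt with rfl | hlt
          · exact le_rfl
          · have := hg hlt
            dsimp only
            split_ifs <;> omega
        exact (h k t _ ht htm (hmono.strictMono_of_injective hinj)).le
      · simp only [Function.Injective, not_forall] at hinj
        obtain ⟨j, j', he, hne⟩ := hinj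
        rw [Matrix.det_zero_of_column_eq hne]
        intro i
        simp only [Matrix.of_apply]
        rw [he]
  · refine ⟨Finset.univ, Finset.mem_univ _, ?_⟩
    apply mul_pos
    · exact Finset.prod_pos (fun j _ => by simpa using ha _)
    · simpa using h k t g ht htm hg

theorem STPFam.scale {φ : ℕ → ℝ → ℝ} (h : STPFam φ) (a : ℕ → ℝ)
    (ha : ∀ s, 0 < a s) : STPFam (fun s x => a s * φ s x) := by
  have := h.bidiag a (fun _ => 0) ha (fun _ => le_rfl)
  simpa using this

open Polynomial in
theorem signVar_lt_card (N : ℕ) : ∀ P : ℝ[X], P ≠ 0 → P.support.card = N →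
    P.signVariations + 1 ≤ N := by
  induction N with
  | zero => intro P hP h; simp_all
  | succ N ih =>
    intro P hP h
    have h1 := P.signVariations_le_eraseLead_succ
    have h2 := Polynomial.card_support_eraseLead' h
    by_cases h0 : P.eraseLead = 0
    · have := signVariations_eq_eraseLead_add_ite hP
      rw [h0] at this
      simp [hP] at this
      omega
    · have := ih _ h0 h2
      omega

open Polynomial in
theorem pos_roots_card (P : ℝ[X]) (hP : P ≠ 0) (S : Finset ℝ)
    (hS : ∀ x ∈ S, 0 < x ∧ P.IsRoot x) : S.card + 1 ≤ P.support.card := by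
  have h1 := signVar_lt_card _ P hP rfl
  have h2 := P.roots_countP_pos_le_signVariations
  have h3 : S.card ≤ P.roots.countP (0 < ·) := by
    rw [Multiset.countP_eq_card_filter, ← Finset.card_val]
    apply Multiset.card_le_card
    rw [Multiset.le_iff_subset S.nodup]
    intro x hx
    have := hS x hx
    simp [hP, this.1]
    exact this.2
  omega

open Polynomial in
theorem STPFam.monomials : STPFam (fun s x => x ^ s) := by
  intro k
  induction k with
  | zero => intro t g _ _ _; simp
  | succ k ih =>
    intro t g ht htm hg
    -- the determinant as a polynomial in the last node
    let c : Fin (k + 1) → ℝ := fun j => (-1) ^ (k + j : ℕ) *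
      (Matrix.of fun i l : Fin k => (t i.castSucc) ^ (g (j.succAbove l))).det
    let P : ℝ[X] := ∑ j, Polynomial.monomial (g j) (c j)
    have heval : ∀ x : ℝ, P.eval x =
        (Matrix.of fun i j : Fin (k + 1) => (Fin.snoc (fun i : Fin k => t i.castSucc) x : Fin (k + 1) → ℝ) i ^ (g j)).det := by
      intro x
      rw [Matrix.det_succ_row _ (Fin.last k)]
      simp only [P, Polynomial.eval_finsetSum, Polynomial.eval_monomial, c]
      refine Finset.sum_congr rfl fun j _ => ?_
      simp only [Fin.val_last, Matrix.of_apply, Fin.snoc_last]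
      rw [mul_right_comm]
      congr 2
      ext i l
      simp [Matrix.submatrix, Fin.succAbove_last, Fin.snoc_castSucc]
    have hgoal : (Matrix.of fun i j : Fin (k + 1) => (t i) ^ (g j)).det = P.eval (t (Fin.last k)) := by
      rw [heval]
      congr 1
      ext i j
      refine Fin.lastCases ?_ (fun i => ?_) i <;> simp
    have hcl : 0 < c (Fin.last k) := by
      have := ih (fun i => t i.castSucc) (fun l => g l.castSucc) (fun i => ht _)
        (fun i j hij => htm (Fin.castSucc_lt_castSucc_iff.2 hij))
        (fun i j hij => hg (Fin.castSucc_lt_castSucc_iff.2 hij))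
      simp only [c, Fin.val_last, Fin.succAbove_last, Even.neg_one_pow ⟨k, rfl⟩, one_mul]
      exact this
    have hcoeff : ∀ d, P.coeff d = ∑ j, if g j = d then c j else 0 := by
      intro d
      simp [P, Polynomial.coeff_monomial]
    have hlc : P.coeff (g (Fin.last k)) = c (Fin.last k) := by
      rw [hcoeff]
      simp [hg.injective.eq_iff]
    have hP : P ≠ 0 := by
      intro h
      rw [h] at hlc
      simp at hlc
      linarith
    have hdeg : P.natDegree = g (Fin.last k) := by
      apply Polynomial.natDegree_eq_of_le_of_coeff_ne_zero
      · apply Polynomial.natDegree_sum_le_of_forall_le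
        intro j _
        exact (Polynomial.natDegree_monomial_le _).trans (hg.monotone (Fin.le_last j))
      · rw [hlc]; exact hcl.ne'
    have hsupp : P.support.card ≤ k + 1 := by
      have : P.support ⊆ Finset.univ.image g := by
        intro d hd
        rw [Polynomial.mem_support_iff, hcoeff] at hd
        obtain ⟨j, _, hj⟩ := Finset.exists_ne_zero_of_sum_ne_zero hd
        simp only [Finset.mem_image, Finset.mem_univ, true_and]
        refine ⟨j, ?_⟩
        by_contra hne
        simp [hne] at hj
      exact (Finset.card_le_card this).trans (Finset.card_image_le.trans (by simp))
    have hroot : ∀ i : Fin k, P.IsRoot (t i.castSucc) := by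
      intro i
      rw [Polynomial.IsRoot, heval]
      apply Matrix.det_zero_of_row_eq (i := i.castSucc) (j := Fin.last k) (Fin.castSucc_lt_last i).ne
      ext j
      simp
    -- no root beyond
    have hno : ∀ y, t (Fin.last k) ≤ y → ¬ P.IsRoot y := by
      intro y hy hr
      have hmem : ∀ i : Fin k, t i.castSucc < y := fun i =>
        (htm (Fin.castSucc_lt_last i)).trans_le hy
      have h1 := pos_roots_card P hP (insert y (Finset.univ.image fun i : Fin k => t i.castSucc)) (by
        intro x hx
        simp only [Finset.mem_insert, Finset.mem_image, Finset.mem_univ, true_and] at hx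
        rcases hx with rfl | ⟨i, rfl⟩
        · exact ⟨(ht _).trans_le hy, hr⟩
        · exact ⟨ht _, hroot i⟩)
      rw [Finset.card_insert_of_notMem, Finset.card_image_of_injective] at h1
      · simp at h1; omega
      · intro i j hij
        exact Fin.castSucc_injective _ (htm.injective hij)
      · simp only [Finset.mem_image, Finset.mem_univ, true_and, not_exists]
        intro i
        exact (hmem i).ne
    change 0 < (Matrix.of fun i j : Fin (k + 1) => (t i) ^ (g j)).det
    rw [hgoal]
    by_contra hneg
    push Not at hneg
    have hbig : ∃ y, t (Fin.last k) ≤ y ∧ 0 ≤ P.eval y := by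
      by_cases hd : 0 < P.natDegree
      · have := P.tendsto_atTop_of_leadingCoeff_nonneg (Polynomial.natDegree_pos_iff_degree_pos.1 hd)
          (by rw [Polynomial.leadingCoeff, hdeg, hlc]; exact hcl.le)
        obtain ⟨y, hy1, hy2⟩ := ((Filter.eventually_ge_atTop (t (Fin.last k))).and
          (this.eventually_ge_atTop 0)).exists
        exact ⟨y, hy1, hy2⟩
      · refine ⟨t (Fin.last k), le_rfl, ?_⟩
        have hd0 : P.natDegree = 0 := by omega
        rw [Polynomial.eq_C_of_natDegree_eq_zero hd0, Polynomial.eval_C]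
        rw [← hd0, hdeg, hlc]
        exact hcl.le
    obtain ⟨y, hy, hPy⟩ := hbig
    obtain ⟨z, hz, hz0⟩ := intermediate_value_Icc hy (P.continuous.continuousOn) ⟨hneg, hPy⟩
    exact hno z hz.1 hz0

/-- Successive bidiagonal transformations. -/
noncomputable def theta (v : ℕ → ℝ) (φ : ℕ → ℝ → ℝ) : ℕ → ℕ → ℝ → ℝ
  | 0 => φ
  | j + 1 => fun s x => if s ≤ j + 1 then theta v φ j s x
      else (v (s - 1) - v j) * theta v φ j s x + theta v φ j (s - 1) x

theorem theta_stp (v : ℕ → ℝ) (hv : StrictMono v) (φ : ℕ → ℝ → ℝ) (h : STPFam φ) (j : ℕ) :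
    STPFam (theta v φ j) := by
  induction j with
  | zero => exact h
  | succ j ih =>
    have := ih.bidiag (fun s => if s ≤ j + 1 then 1 else v (s - 1) - v j)
      (fun s => if s ≤ j + 1 then 0 else 1) (by
        intro s
        split_ifs with hs
        · exact one_pos
        · exact sub_pos.2 (hv (by omega))) (by
        intro s
        split_ifs <;> norm_num)
    convert this using 1
    funext s x
    by_cases hs : s ≤ j + 1 <;> simp [theta, hs]

theorem theta_stable (v : ℕ → ℝ) (φ : ℕ → ℝ → ℝ) (m j : ℕ) :
    theta v φ (m + j) (m + 1) = theta v φ m (m + 1) := by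
  induction j with
  | zero => rfl
  | succ j ih =>
    rw [← ih]
    funext x
    simp [theta]

theorem theta_zero (v : ℕ → ℝ) (φ : ℕ → ℝ → ℝ) (j : ℕ) :
    theta v φ j 0 = φ 0 := by
  induction j with
  | zero => rfl
  | succ j ih =>
    rw [← ih]
    funext x
    simp [theta]

theorem theta_step (v : ℕ → ℝ) (φ : ℕ → ℝ → ℝ) (x : ℝ) (j M : ℕ) :
    ∑ k ∈ range (M + 2), (∏ i ∈ range k, (v (j + (M + 1)) - v (j + i))) * theta v φ j (j + k + 1) x
    = ∑ k ∈ range (M + 1), (∏ i ∈ range k, (v (j + (M + 1)) - v (j + 1 + i))) *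
        theta v φ (j + 1) (j + 1 + k + 1) x := by
  set w := v (j + (M + 1)) with hw
  have hN : ∀ k, ∏ i ∈ range (k + 1), (w - v (j + i)) =
      ∏ i ∈ range (k + 1), (w - v (j + 1 + i)) +
        (v (j + k + 1) - v j) * ∏ i ∈ range k, (w - v (j + 1 + i)) := by
    intro k
    rw [prod_range_succ', prod_range_succ]
    have : ∏ i ∈ range k, (w - v (j + (i + 1))) = ∏ i ∈ range k, (w - v (j + 1 + i)) :=
      prod_congr rfl fun i _ => by rw [show j + (i + 1) = j + 1 + i by omega]
    rw [this, add_zero]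
    rw [show j + 1 + k = j + k + 1 by omega]
    ring
  have hth : ∀ k, theta v φ (j + 1) (j + 1 + k + 1) x =
      (v (j + k + 1) - v j) * theta v φ j (j + (k + 1) + 1) x + theta v φ j (j + k + 1) x := by
    intro k
    rw [theta]
    beta_reduce
    rw [if_neg (by omega)]
    rw [show j + 1 + k + 1 - 1 = j + k + 1 by omega, show j + 1 + k + 1 = j + (k + 1) + 1 by omega]
  have hzero : ∏ i ∈ range (M + 1), (w - v (j + 1 + i)) = 0 := by
    rw [prod_range_succ, hw, show j + (M + 1) = j + 1 + M by omega]
    simp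
  rw [sum_range_succ']
  simp only [hN, hth]
  have h1 : ∑ k ∈ range (M + 1), (∏ i ∈ range k, (w - v (j + 1 + i))) * theta v φ j (j + k + 1) x
      = ∑ k ∈ range (M + 1), (∏ i ∈ range (k + 1), (w - v (j + 1 + i))) *
          theta v φ j (j + (k + 1) + 1) x + theta v φ j (j + 0 + 1) x := by
    have := sum_range_succ (fun k => (∏ i ∈ range k, (w - v (j + 1 + i))) *
      theta v φ j (j + k + 1) x) (M + 1)
    rw [hzero, zero_mul, add_zero] at this
    rw [← this, sum_range_succ']
    simp
  simp only [mul_add, add_mul, sum_add_distrib, h1]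
  simp only [range_zero, prod_empty, one_mul, add_zero]
  have h2 : ∀ k ∈ range (M + 1), (v (j + k + 1) - v j) * (∏ i ∈ range k, (w - v (j + 1 + i))) *
      theta v φ j (j + (k + 1) + 1) x = (∏ i ∈ range k, (w - v (j + 1 + i))) *
      ((v (j + k + 1) - v j) * theta v φ j (j + (k + 1) + 1) x) := fun k _ => by ring
  rw [sum_congr rfl h2]
  ring

theorem theta_inv (v : ℕ → ℝ) (φ : ℕ → ℝ → ℝ) (x : ℝ) (M : ℕ) : ∀ j,
    ∑ k ∈ range (M + 1), (∏ i ∈ range k, (v (j + M) - v (j + i))) * theta v φ j (j + k + 1) x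
    = theta v φ (j + M) (j + M + 1) x := by
  induction M with
  | zero => intro j; simp
  | succ M ih =>
    intro j
    rw [theta_step]
    have := ih (j + 1)
    rw [show j + (M + 1) = j + 1 + M by omega]
    exact this

theorem qInt_pos {q : ℝ} (hq : 0 < q) (m : ℕ) : 0 < qInt q (m + 1) :=
  Finset.sum_pos (fun i _ => pow_pos hq i) ⟨0, by simp⟩

theorem qInt_add (q : ℝ) (a b : ℕ) : qInt q (a + b) = qInt q a + q ^ a * qInt q b := by
  simp [qInt, sum_range_add, pow_add, mul_sum]

noncomputable def cq (q : ℝ) (m k : ℕ) : ℝ :=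
  (∏ i ∈ range k, q ^ (i + 1) / qInt q (i + 1)) * ∏ i ∈ range k, qInt q (m - i)

theorem cq_pascal {q : ℝ} (hq : 0 < q) (m k : ℕ) (hk : k ≤ m) :
    cq q (m + 1) (k + 1) = cq q m (k + 1) + q ^ (m + 1) * cq q m k := by
  unfold cq
  rw [prod_range_succ' (fun i => qInt q (m + 1 - i)), prod_range_succ _ k, prod_range_succ _ k]
  obtain ⟨d, rfl⟩ := Nat.exists_eq_add_of_le hk
  have h0 := (qInt_pos hq k).ne'
  simp only [Nat.add_sub_add_right, Nat.sub_zero, Nat.add_sub_cancel_left]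
  have : qInt q (k + d + 1) = qInt q d + q ^ d * qInt q (k + 1) := by
    rw [← qInt_add]; congr 1; omega
  rw [this]
  field_simp
  ring

theorem cq_zero (q : ℝ) (m : ℕ) : cq q m 0 = 1 := by simp [cq]

theorem cq_top (q : ℝ) (m : ℕ) : cq q m (m + 1) = 0 := by
  simp [cq, prod_range_succ, qInt]

theorem qbinom_thm {q : ℝ} (hq : 0 < q) (x y : ℝ) (m : ℕ) :
    ∏ j ∈ Finset.Icc 1 m, (x * q ^ j + y) = ∑ k ∈ range (m + 1), cq q m k * x ^ k * y ^ (m - k) := by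
  induction m with
  | zero => simp [cq_zero]
  | succ m ih =>
    rw [Finset.prod_Icc_succ_top (by omega), ih]
    rw [sum_range_succ' _ (m + 1)]
    have h1 : ∑ k ∈ range (m + 1), cq q (m + 1) (k + 1) * x ^ (k + 1) * y ^ (m + 1 - (k + 1))
        = ∑ k ∈ range (m + 1), cq q m (k + 1) * x ^ (k + 1) * y ^ (m - k) +
          x * q ^ (m + 1) * ∑ k ∈ range (m + 1), cq q m k * x ^ k * y ^ (m - k) := by
      rw [mul_sum, ← sum_add_distrib]
      refine sum_congr rfl fun k hk => ?_
      rw [cq_pascal hq m k (by simp at hk; omega), Nat.add_sub_add_right]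
      ring
    have h2 : (∑ k ∈ range (m + 1), cq q m k * x ^ k * y ^ (m - k)) * y
        = ∑ k ∈ range (m + 1), cq q m (k + 1) * x ^ (k + 1) * y ^ (m - k) + y ^ (m + 1) := by
      have h3 := sum_range_succ (fun k => cq q m k * x ^ k * y ^ (m + 1 - k)) (m + 1)
      rw [cq_top, sum_range_succ'] at h3
      simp only [Nat.add_sub_add_right, cq_zero, zero_mul, add_zero, pow_zero, one_mul,
        Nat.sub_zero] at h3
      rw [h3, sum_mul]
      refine sum_congr rfl fun k hk => ?_
      rw [show m + 1 - k = (m - k) + 1 by simp at hk; omega]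
      ring
    rw [h1, mul_add, h2, cq_zero]
    simp only [pow_zero, Nat.sub_zero]
    ring

theorem node_sub {q : ℝ} (hq : 0 < q) (m i : ℕ) (h : i ≤ m) :
    (-(1 / qInt q (m + 1))) - (-(1 / qInt q (i + 1)))
      = q ^ (i + 1) / qInt q (i + 1) * qInt q (m - i) / qInt q (m + 1) := by
  obtain ⟨d, rfl⟩ := Nat.exists_eq_add_of_le h
  have h0 := (qInt_pos hq i).ne'
  have h1 := (qInt_pos hq (i + d)).ne'
  have : qInt q (i + d + 1) = qInt q (i + 1) + q ^ (i + 1) * qInt q d := by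
    rw [← qInt_add]; congr 1; omega
  rw [Nat.add_sub_cancel_left]
  field_simp
  rw [this]
  ring

theorem nodes_mono {q : ℝ} (hq : 0 < q) : StrictMono (fun m => -(1 / qInt q (m + 1))) := by
  apply strictMono_nat_of_lt_succ
  intro m
  have h0 := qInt_pos hq m
  have : qInt q (m + 1) < qInt q (m + 1 + 1) := by
    have := pow_pos hq (m + 1)
    rw [qInt, qInt, sum_range_succ _ (m + 1)]
    linarith
  exact neg_lt_neg (one_div_lt_one_div_of_lt h0 this)

theorem qAbel_stp (q α : ℝ) (hq : 0 < q) (hα : α < 0) (n : ℕ) :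
    ∃ ψ, STPFam ψ ∧ ∀ s, s ≤ n → ∀ x, ψ s x = qAbel q α s x := by
  set v : ℕ → ℝ := fun m => -(1 / qInt q (m + 1)) with hv
  set φ : ℕ → ℝ → ℝ := fun s x => ((-α) ^ (s - 1))⁻¹ * x ^ s with hφ
  have ha : 0 < -α := by linarith
  have h1 : STPFam φ := STPFam.monomials.scale (fun s => ((-α) ^ (s - 1))⁻¹)
    (fun s => inv_pos.2 (pow_pos ha _))
  have h2 := (theta_stp v (nodes_mono hq) φ h1 n).scale
    (fun s => if s = 0 then 1 else (-α * qInt q s) ^ (s - 1)) (by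
      intro s
      split_ifs with hs
      · exact one_pos
      · obtain ⟨m, rfl⟩ := Nat.exists_eq_succ_of_ne_zero hs
        exact pow_pos (mul_pos ha (qInt_pos hq m)) _)
  refine ⟨_, h2, ?_⟩
  intro s hs x
  rcases s with _ | m
  · simp [theta_zero, qAbel, hφ]
  · obtain ⟨d, rfl⟩ := Nat.exists_eq_add_of_le (show m ≤ n by omega)
    simp only [theta_stable, Nat.add_eq_zero_iff, one_ne_zero, and_false, if_false,
      Nat.add_sub_cancel, qAbel]
    have h3 := theta_inv v φ x m 0
    simp only [zero_add] at h3
    rw [← h3]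
    have h4 := qbinom_thm hq x (-α * qInt q (m + 1)) m
    have h5 : ∀ j, x * q ^ j - α * qInt q (m + 1) = x * q ^ j + -α * qInt q (m + 1) :=
      fun j => by ring
    simp only [h5, h4]
    rw [mul_sum, mul_sum]
    refine sum_congr rfl fun k hk => ?_
    have hkm : k ≤ m := by simp at hk; omega
    have h6 : ∏ i ∈ range k, (v m - v i) = cq q m k / qInt q (m + 1) ^ k := by
      rw [cq, ← prod_mul_distrib, ← card_range k, ← prod_const, card_range, ← prod_div_distrib]
      refine prod_congr rfl fun i hi => ?_
      exact node_sub hq m i (by simp at hi; omega)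
    rw [h6]
    simp only [theta, hφ, Nat.add_sub_cancel]
    obtain ⟨e, rfl⟩ := Nat.exists_eq_add_of_le hkm
    have h7 := (qInt_pos hq (k + e)).ne'
    have h8 := ha.ne'
    rw [Nat.add_sub_cancel_left, mul_pow, mul_pow, pow_add, pow_add]
    generalize qInt q (k + e + 1) = Q at *
    generalize -α = a at *
    field_simp
    ring

theorem qAbel_stp_zero (q : ℝ) (hq : 0 < q) :
    ∃ ψ, STPFam ψ ∧ ∀ s, ∀ x, ψ s x = qAbel q 0 s x := by
  refine ⟨_, STPFam.monomials.scale (fun s => ∏ j ∈ Finset.Icc 1 (s - 1), q ^ j)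
    (fun s => prod_pos fun j _ => pow_pos hq j), ?_⟩
  intro s x
  rcases s with _ | m
  · simp [qAbel]
  · simp [qAbel, prod_mul_distrib]
    ring

theorem qAbel_basis_strictTotallyPos (q α : ℝ) (hq : 0 < q) (hα : α ≤ 0) (n : ℕ) :
    ∀ t : Fin (n + 1) → ℝ, 0 < t 0 → StrictMono t →
      IsStrictTotallyPos
        (Matrix.of fun i j : Fin (n + 1) => qAbel q α (j : ℕ) (t i)) := by
  intro t ht0 htm k f g hf hg
  obtain ⟨ψ, hψ, he⟩ : ∃ ψ, STPFam ψ ∧ ∀ s, s ≤ n → ∀ x, ψ s x = qAbel q α s x := by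
    rcases hα.lt_or_eq with h | rfl
    · exact qAbel_stp q α hq h n
    · obtain ⟨ψ, h1, h2⟩ := qAbel_stp_zero q hq
      exact ⟨ψ, h1, fun s _ => h2 s⟩
  have := hψ k (fun i => t (f i)) (fun j => (g j : ℕ))
    (fun i => ht0.trans_le (htm.monotone (Fin.zero_le _))) (htm.comp hf) (fun i j hij => hg hij)
  convert this using 2
  ext i j
  simp [he (g j) (by omega)]
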